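/- arXiv:math/0604579 — 4 statements merged into one kernel-verified Lean document; each statement's English description precedes it below -/
import Mathlib

section
/- Let U ⊆ ℂ be open, let ω₁,…,ω_g : U → ℂ be holomorphic, let A = (a_{ij}) be a real symmetric positive definite g×g matrix, and suppose the Bergman-type density ρ(z) = Σ_{i,j=1}^g a_{ij} ω_i(z)·conj(ω_j(z)) is strictly positive on U. Then Δ(log ρ)(z) ≥ 0 for every z ∈ U (i.e. log ρ is subharmonic on U); equivalently, the Gaussian curvature K = −(1/(2ρ))Δ(log ρ) of the conformal metric ρ|dz|² satisfies K(z) ≤ 0 for all z ∈ U. -/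
open Complex ComplexConjugate

/-- The planar Laplacian of `u : ℂ → ℝ` at `z`: the sum of the second directional
derivatives in the directions `1` and `I` (i.e. `∂²u/∂x² + ∂²u/∂y²` on `ℂ ≅ ℝ²`). -/
noncomputable def planarLaplacian (u : ℂ → ℝ) (z : ℂ) : ℝ :=
  deriv (fun x : ℝ => deriv (fun t : ℝ => u (z + t)) x) 0 +
  deriv (fun x : ℝ => deriv (fun t : ℝ => u (z + t * Complex.I)) x) 0

section LogNormSq

variable {E : Type*} [NormedAddCommGroup E] [InnerProductSpace ℂ E]

theorem HasDerivAt.comp_line {F : ℂ → E} {F' : E} {z e : ℂ} {x : ℝ}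
    (h : HasDerivAt F F' (z + x * e)) :
    HasDerivAt (fun t : ℝ => F (z + t * e)) (e • F') x := by
  have hl : HasDerivAt (fun t : ℝ => z + t * e) e x := by
    simpa using ((Complex.ofRealCLM.hasDerivAt (x := x)).mul_const e).const_add z
  exact HasDerivAt.scomp x h hl

theorem hasDerivAt_re_inner {f k : ℝ → E} {f' k' : E} {x : ℝ}
    (hf : HasDerivAt f f' x) (hk : HasDerivAt k k' x) :
    HasDerivAt (fun t => (inner ℂ (f t) (k t)).re)
      ((inner ℂ (f x) k').re + (inner ℂ f' (k x)).re) x :=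
  Complex.reCLM.hasFDerivAt.comp_hasDerivAt x (hf.inner ℂ hk)

/-- Second derivative of `log ‖F‖²` along a line, for `F` holomorphic and nonvanishing. -/
theorem deriv_deriv_log_norm_sq_line [CompleteSpace E] {U : Set ℂ} (hU : IsOpen U) {F : ℂ → E}
    (hF : DifferentiableOn ℂ F U) (hF0 : ∀ w ∈ U, F w ≠ 0) {z : ℂ} (hz : z ∈ U) (e : ℂ) :
    deriv (fun x : ℝ => deriv (fun t : ℝ => Real.log (‖F (z + t * e)‖ ^ 2)) x) 0 =
      (2 * ((inner ℂ (F z) (e ^ 2 • deriv (deriv F) z)).re + ‖e • deriv F z‖ ^ 2) * ‖F z‖ ^ 2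
        - (2 * (inner ℂ (F z) (e • deriv F z)).re) ^ 2) / (‖F z‖ ^ 2) ^ 2 := by
  have hd {w : ℂ} (hw : w ∈ U) : HasDerivAt F (deriv F w) w :=
    (hF.differentiableAt (hU.mem_nhds hw)).hasDerivAt
  have hd2 : HasDerivAt (deriv F) (deriv (deriv F) z) z :=
    ((hF.deriv hU).differentiableAt (hU.mem_nhds hz)).hasDerivAt
  have hsq {x : ℝ} (hx : z + x * e ∈ U) : HasDerivAt (fun t : ℝ => ‖F (z + t * e)‖ ^ 2)
      (2 * (inner ℂ (F (z + x * e)) (e • deriv F (z + x * e))).re) x := by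
    have h := hasDerivAt_re_inner (hd hx).comp_line (hd hx).comp_line
    have hsymm := inner_re_symm (𝕜 := ℂ) (e • deriv F (z + x * e)) (F (z + x * e))
    simp only [RCLike.re_to_complex] at hsymm
    rw [hsymm, ← two_mul] at h
    refine h.congr_of_eventuallyEq (.of_forall fun t => ?_)
    exact (inner_self_eq_norm_sq (𝕜 := ℂ) (F (z + t * e))).symm
  have hne {w : ℂ} (hw : w ∈ U) : ‖F w‖ ^ 2 ≠ 0 := by simpa using hF0 w hw
  have hcont : Continuous fun x : ℝ => z + x * e := by fun_prop
  have hmem : ∀ᶠ x : ℝ in nhds 0, z + x * e ∈ U :=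
    hcont.continuousAt.eventually_mem (hU.mem_nhds (by simpa using hz))
  have hfirst : (fun x : ℝ => deriv (fun t : ℝ => Real.log (‖F (z + t * e)‖ ^ 2)) x) =ᶠ[nhds 0]
      fun x : ℝ => 2 * (inner ℂ (F (z + x * e)) (e • deriv F (z + x * e))).re
        / ‖F (z + x * e)‖ ^ 2 := by
    filter_upwards [hmem] with x hx
    exact ((hsq hx).log (hne hx)).deriv
  have hz' : z + (0 : ℝ) * e = z := by simp
  have h1 : HasDerivAt (fun t : ℝ => F (z + t * e)) (e • deriv F z) 0 :=
    HasDerivAt.comp_line (by rw [hz']; exact hd hz)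
  have h2 : HasDerivAt (fun t : ℝ => e • deriv F (z + t * e)) (e • e • deriv (deriv F) z) 0 :=
    (HasDerivAt.comp_line (by rw [hz']; exact hd2)).const_smul e
  have hquot := ((hasDerivAt_re_inner h1 h2).const_mul 2).div
    (hsq (hz'.symm ▸ hz)) (hne (hz'.symm ▸ hz))
  refine hfirst.deriv_eq.trans (hquot.deriv.trans ?_)
  have hself := inner_self_eq_norm_sq (𝕜 := ℂ) (e • deriv F z)
  simp only [RCLike.re_to_complex] at hself
  rw [hz', hself, smul_smul, ← pow_two]
  ring

theorem planarLaplacian_log_norm_sq_nonneg [CompleteSpace E] {U : Set ℂ} (hU : IsOpen U)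
    {F : ℂ → E} (hF : DifferentiableOn ℂ F U) (hF0 : ∀ w ∈ U, F w ≠ 0) {z : ℂ} (hz : z ∈ U) :
    0 ≤ planarLaplacian (fun w => Real.log (‖F w‖ ^ 2)) z := by
  have h1 := deriv_deriv_log_norm_sq_line hU hF hF0 hz 1
  have hI := deriv_deriv_log_norm_sq_line hU hF hF0 hz Complex.I
  simp only [mul_one, one_pow, one_smul] at h1
  rw [planarLaplacian, h1, hI, ← add_div]
  refine div_nonneg ?_ (by positivity)
  have hcs : ‖inner ℂ (F z) (deriv F z)‖ ^ 2 ≤ (‖F z‖ * ‖deriv F z‖) ^ 2 :=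
    pow_le_pow_left₀ (norm_nonneg _) (norm_inner_le_norm _ _) 2
  rw [Complex.sq_norm, Complex.normSq_apply, mul_pow] at hcs
  simp only [Complex.I_sq, neg_smul, one_smul, inner_neg_right, inner_smul_right, norm_smul,
    Complex.norm_I, one_mul, Complex.neg_re, Complex.I_mul_re]
  linarith

end LogNormSq

/-- A real Gram matrix `Bᵀ B` gives the Hermitian form `v ↦ ‖B v‖²` on complex vectors. -/
theorem Matrix.re_sum_transpose_mul_self_eq_norm_sq {m n : Type*} [Fintype m] [Fintype n]
    (B : Matrix m n ℝ) (v : n → ℂ) :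
    (∑ i, ∑ j, ((B.transpose * B) i j : ℂ) * v i * conj (v j)).re =
      ‖WithLp.toLp 2 (fun k => ∑ j, (B k j : ℂ) * v j)‖ ^ 2 := by
  rw [EuclideanSpace.norm_sq_eq, ← Complex.ofReal_re (∑ k, _ ^ 2)]
  congr 1
  push_cast
  simp only [← Complex.mul_conj', map_sum, map_mul, Complex.conj_ofReal, Matrix.mul_apply,
    Matrix.transpose_apply, Complex.ofReal_sum, Complex.ofReal_mul, Finset.sum_mul,
    Finset.mul_sum]
  rw [Finset.sum_comm_cycle]
  refine Finset.sum_congr rfl fun k _ => ?_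
  rw [Finset.sum_comm]
  exact Finset.sum_congr rfl fun i _ => Finset.sum_congr rfl fun j _ => by ring

open scoped MatrixOrder ComplexOrder Matrix.Norms.L2Operator in
theorem Matrix.PosSemidef.exists_eq_transpose_mul_self {n : Type*} [Fintype n]
    {A : Matrix n n ℝ} (hA : A.PosSemidef) : ∃ B : Matrix n n ℝ, A = B.transpose * B := by
  classical
  obtain ⟨B, hB⟩ := CStarAlgebra.nonneg_iff_eq_star_mul_self.mp hA.nonneg
  exact ⟨B, by
    rwa [Matrix.star_eq_conjTranspose, Matrix.conjTranspose_eq_transpose_of_trivial] at hB⟩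

/-- For a Bergman-type density `ρ = ∑ aᵢⱼ ωᵢ ω̄ⱼ` with `A` real symmetric positive definite
and the `ωᵢ` holomorphic, `log ρ` is subharmonic: `Δ(log ρ) ≥ 0`, equivalently the
Gaussian curvature `K = −(1/(2ρ))Δ(log ρ)` of the metric `ρ|dz|²` is nonpositive. -/
theorem bergman_curvature_nonpositive {g : ℕ} (U : Set ℂ) (hU : IsOpen U)
    (ω : Fin g → ℂ → ℂ) (hω : ∀ i, DifferentiableOn ℂ (ω i) U)
    (A : Matrix (Fin g) (Fin g) ℝ) (hA : A.PosDef)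
    (ρ : ℂ → ℝ)
    (hρ : ∀ z, ρ z = (∑ i, ∑ j, (A i j : ℂ) * ω i z * conj (ω j z)).re)
    (hρpos : ∀ z ∈ U, 0 < ρ z) :
    ∀ z ∈ U,
      0 ≤ planarLaplacian (fun w => Real.log (ρ w)) z ∧
      -(1 / (2 * ρ z)) * planarLaplacian (fun w => Real.log (ρ w)) z ≤ 0 := by
  obtain ⟨B, hB⟩ := hA.posSemidef.exists_eq_transpose_mul_self
  let F : ℂ → EuclideanSpace ℂ (Fin g) :=
    fun w => WithLp.toLp 2 fun k => ∑ j, (B k j : ℂ) * ω j w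
  have hρF (w : ℂ) : ρ w = ‖F w‖ ^ 2 := by
    rw [hρ, hB]
    exact B.re_sum_transpose_mul_self_eq_norm_sq fun i => ω i w
  have hF : DifferentiableOn ℂ F U := by
    refine (differentiableOn_euclidean (𝕜 := ℂ)).mpr fun k => ?_
    exact DifferentiableOn.fun_sum (u := Finset.univ) fun j _ => (hω j).const_mul (B k j : ℂ)
  have hF0 : ∀ w ∈ U, F w ≠ 0 := fun w hw h0 => by
    simpa [hρF, h0] using hρpos w hw
  intro z hz
  have hΔ : 0 ≤ planarLaplacian (fun w => Real.log (ρ w)) z := by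
    simpa only [hρF] using planarLaplacian_log_norm_sq_nonneg hU hF hF0 hz
  refine ⟨hΔ, mul_nonpos_of_nonpos_of_nonneg ?_ hΔ⟩
  have := hρpos z hz
  exact neg_nonpos.mpr (by positivity)
end

section
/- Let U ⊆ ℂ be open, let ω₁,…,ω_g : U → ℂ be holomorphic, let A = (a_{ij}) be a real symmetric positive definite g×g matrix, and suppose the Bergman-type density ρ(z) = Σ_{i,j=1}^g a_{ij} ω_i(z)·conj(ω_j(z)) is strictly positive on U. Then for z₀ ∈ U, the Gaussian curvature K = −(1/(2ρ))Δ(log ρ) vanishes at z₀ if and only if there exists λ ∈ ℂ such that ω_i′(z₀) = λ·ω_i(z₀) for every i = 1,…,g, i.e. if and only if the vectors (ω₁(z₀),…,ω_g(z₀)) and (ω₁′(z₀),…,ω_g′(z₀)) in ℂ^g are ℂ-linearly dependent. -/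
open Complex ComplexConjugate

section BergmanForm

open Filter Topology

variable {ι : Type*} [Fintype ι]

/-- The sesquilinear form `(u, v) ↦ ∑ aᵢⱼ uᵢ v̄ⱼ` on `ℂ^ι` attached to a real matrix. -/
noncomputable def bergmanForm (A : Matrix ι ι ℝ) (u v : ι → ℂ) : ℂ :=
  ∑ i, ∑ j, (A i j : ℂ) * u i * conj (v j)

lemma bergmanForm_sub_left (A : Matrix ι ι ℝ) (u v w : ι → ℂ) :
    bergmanForm A (u - v) w = bergmanForm A u w - bergmanForm A v w := by
  simp [bergmanForm, mul_sub, sub_mul, Finset.sum_sub_distrib]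

lemma bergmanForm_sub_right (A : Matrix ι ι ℝ) (u v w : ι → ℂ) :
    bergmanForm A u (v - w) = bergmanForm A u v - bergmanForm A u w := by
  simp [bergmanForm, mul_sub, Finset.sum_sub_distrib]

lemma bergmanForm_smul_left (A : Matrix ι ι ℝ) (c : ℂ) (u v : ι → ℂ) :
    bergmanForm A (c • u) v = c * bergmanForm A u v := by
  simp only [bergmanForm, Finset.mul_sum, Pi.smul_apply, smul_eq_mul]
  exact Finset.sum_congr rfl fun i _ => Finset.sum_congr rfl fun j _ => by ring

lemma bergmanForm_smul_right (A : Matrix ι ι ℝ) (c : ℂ) (u v : ι → ℂ) :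
    bergmanForm A u (c • v) = conj c * bergmanForm A u v := by
  simp only [bergmanForm, Finset.mul_sum, Pi.smul_apply, smul_eq_mul, map_mul]
  exact Finset.sum_congr rfl fun i _ => Finset.sum_congr rfl fun j _ => by ring

lemma bergmanForm_conj_symm {A : Matrix ι ι ℝ} (hA : A.IsHermitian) (u v : ι → ℂ) :
    conj (bergmanForm A u v) = bergmanForm A v u := by
  simp only [bergmanForm, map_sum, map_mul, conj_ofReal, conj_conj]
  rw [Finset.sum_comm]
  refine Finset.sum_congr rfl fun i _ => Finset.sum_congr rfl fun j _ => ?_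
  rw [← hA.apply i j, star_trivial]
  ring

lemma bergmanForm_self_im {A : Matrix ι ι ℝ} (hA : A.IsHermitian) (u : ι → ℂ) :
    (bergmanForm A u u).im = 0 :=
  conj_eq_iff_im.mp (bergmanForm_conj_symm hA u u)

open Matrix in
lemma bergmanForm_self_re (A : Matrix ι ι ℝ) (u : ι → ℂ) :
    (bergmanForm A u u).re = (fun i => (u i).re) ⬝ᵥ (A *ᵥ fun i => (u i).re) +
      (fun i => (u i).im) ⬝ᵥ (A *ᵥ fun i => (u i).im) := by
  simp only [bergmanForm, re_sum, dotProduct, mulVec, Finset.mul_sum, ← Finset.sum_add_distrib]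
  refine Finset.sum_congr rfl fun i _ => Finset.sum_congr rfl fun j _ => ?_
  simp
  ring

lemma bergmanForm_self_re_eq_zero_iff {A : Matrix ι ι ℝ} (hA : A.PosDef) (u : ι → ℂ) :
    (bergmanForm A u u).re = 0 ↔ u = 0 := by
  refine ⟨fun h => ?_, fun h => by simp [h, bergmanForm]⟩
  rw [bergmanForm_self_re] at h
  have nonneg (x : ι → ℝ) := hA.posSemidef.dotProduct_mulVec_nonneg x
  have pos {x : ι → ℝ} (hx : x ≠ 0) := hA.dotProduct_mulVec_pos hx
  simp only [star_trivial] at nonneg pos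
  by_contra hu
  by_cases hre : (fun i => (u i).re) = 0
  · have him : (fun i => (u i).im) ≠ 0 := fun him =>
      hu (funext fun i => Complex.ext (congrFun hre i) (congrFun him i))
    linarith [nonneg fun i => (u i).re, pos him]
  · linarith [nonneg fun i => (u i).im, pos hre]

/-- The equality case of the Cauchy-Schwarz inequality for `bergmanForm`. -/
lemma bergmanForm_cauchySchwarz_eq_iff {A : Matrix ι ι ℝ} (hA : A.PosDef) {u : ι → ℂ}
    (hu : (bergmanForm A u u).re ≠ 0) (v : ι → ℂ) :
    (bergmanForm A u u).re * (bergmanForm A v v).re = normSq (bergmanForm A v u) ↔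
      ∃ l : ℂ, v = l • u := by
  have hherm := hA.isHermitian
  have expand (l : ℂ) : (bergmanForm A (v - l • u) (v - l • u)).re =
      (bergmanForm A v v).re - 2 * (conj l * bergmanForm A v u).re +
        normSq l * (bergmanForm A u u).re := by
    rw [bergmanForm_sub_left, bergmanForm_sub_right, bergmanForm_sub_right,
      bergmanForm_smul_left, bergmanForm_smul_left, bergmanForm_smul_right,
      bergmanForm_smul_right, ← bergmanForm_conj_symm hherm v u]
    simp [normSq_apply, bergmanForm_self_im hherm]
    ring
  constructor
  · intro h
    refine ⟨bergmanForm A v u / (bergmanForm A u u).re, ?_⟩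
    rw [← sub_eq_zero, ← bergmanForm_self_re_eq_zero_iff hA, expand]
    have h1 : (conj (bergmanForm A v u / (bergmanForm A u u).re) * bergmanForm A v u).re =
        normSq (bergmanForm A v u) / (bergmanForm A u u).re := by
      rw [map_div₀, conj_ofReal, div_mul_eq_mul_div, mul_comm, mul_conj, ← ofReal_div, ofReal_re]
    rw [h1, map_div₀, normSq_ofReal, ← h]
    field_simp
    ring
  · rintro ⟨l, rfl⟩
    rw [bergmanForm_smul_left, bergmanForm_smul_left, bergmanForm_smul_right, map_mul,
      ← mul_assoc, mul_conj, re_ofReal_mul, normSq_apply (bergmanForm A u u),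
      bergmanForm_self_im hherm]
    ring

lemma HasDerivAt.bergmanForm (A : Matrix ι ι ℝ) {u v : ℝ → ι → ℂ} {u' v' : ι → ℂ} {t : ℝ}
    (hu : HasDerivAt u u' t) (hv : HasDerivAt v v' t) :
    HasDerivAt (fun s => bergmanForm A (u s) (v s))
      (bergmanForm A u' (v t) + bergmanForm A (u t) v') t := by
  simp only [_root_.bergmanForm, ← Finset.sum_add_distrib]
  refine HasDerivAt.fun_sum fun i _ => HasDerivAt.fun_sum fun j _ => ?_
  exact ((hasDerivAt_pi.mp hu i).const_mul _).mul (hasDerivAt_pi.mp hv j).star |>.congr_deriv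
    (by simp)

/-- The second derivative of the logarithm of the density along the line `t ↦ z + t e`. -/
lemma deriv_deriv_log_bergmanForm {A : Matrix ι ι ℝ} (hA : A.IsHermitian) {U : Set ℂ}
    (hU : IsOpen U) {f : ℂ → ι → ℂ} (hf : DifferentiableOn ℂ f U)
    (hpos : ∀ z ∈ U, 0 < (bergmanForm A (f z) (f z)).re) {z : ℂ} (hz : z ∈ U) (e : ℂ) :
    deriv (fun x : ℝ => deriv (fun t : ℝ =>
        Real.log (bergmanForm A (f (z + t * e)) (f (z + t * e))).re) x) 0 =
      2 * ((e ^ 2 * bergmanForm A (deriv (deriv f) z) (f z)).re +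
          normSq e * (bergmanForm A (deriv f z) (deriv f z)).re) /
        (bergmanForm A (f z) (f z)).re -
      (2 * (e * bergmanForm A (deriv f z) (f z)).re / (bergmanForm A (f z) (f z)).re) ^ 2 := by
  have along {h : ℂ → ι → ℂ} (hh : DifferentiableOn ℂ h U) {t : ℝ} (ht : z + t * e ∈ U) :
      HasDerivAt (fun s : ℝ => h (z + s * e)) (e • deriv h (z + t * e)) t := by
    have hline : HasDerivAt (fun s : ℝ => z + s * e) e t := by
      simpa using (ofRealCLM.hasDerivAt (x := t)).mul_const e |>.const_add z
    exact ((hh.differentiableAt (hU.mem_nhds ht)).hasDerivAt).scomp t hline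
  have first {t : ℝ} (ht : z + t * e ∈ U) :
      HasDerivAt (fun s : ℝ => (bergmanForm A (f (z + s * e)) (f (z + s * e))).re)
        (2 * (e * bergmanForm A (deriv f (z + t * e)) (f (z + t * e))).re) t := by
    have h := reCLM.hasFDerivAt.comp_hasDerivAt t ((along hf ht).bergmanForm A (along hf ht))
    refine h.congr_deriv ?_
    rw [← bergmanForm_conj_symm hA (e • deriv f (z + t * e)), bergmanForm_smul_left]
    simp only [reCLM_apply, add_re, conj_re]
    ring
  have hnear : ∀ᶠ t : ℝ in 𝓝 0, z + t * e ∈ U := by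
    have hc : Continuous fun t : ℝ => z + t * e := by fun_prop
    exact hc.continuousAt.preimage_mem_nhds (hU.mem_nhds (by simpa using hz))
  have hderiv : (fun x : ℝ => deriv (fun t : ℝ =>
        Real.log (bergmanForm A (f (z + t * e)) (f (z + t * e))).re) x) =ᶠ[𝓝 0]
      fun t : ℝ => 2 * (e * bergmanForm A (deriv f (z + t * e)) (f (z + t * e))).re /
        (bergmanForm A (f (z + t * e)) (f (z + t * e))).re := by
    filter_upwards [hnear] with t ht
    exact ((first ht).log (hpos _ ht).ne').deriv
  have hz0 : z + (0 : ℝ) * e ∈ U := by simpa using hz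
  have hnum : HasDerivAt
      (fun t : ℝ => 2 * (e * bergmanForm A (deriv f (z + t * e)) (f (z + t * e))).re)
      (2 * ((e ^ 2 * bergmanForm A (deriv (deriv f) z) (f z)).re +
          normSq e * (bergmanForm A (deriv f z) (deriv f z)).re)) 0 := by
    have h := (((along (hf.deriv hU) hz0).bergmanForm A (along hf hz0)).const_mul e)
    refine ((reCLM.hasFDerivAt.comp_hasDerivAt 0 h).const_mul 2).congr_deriv ?_
    simp only [ofReal_zero, zero_mul, add_zero, bergmanForm_smul_left, bergmanForm_smul_right,
      mul_add, ← mul_assoc, mul_conj, reCLM_apply, add_re, re_ofReal_mul, pow_two]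
  rw [hderiv.deriv_eq, (hnum.fun_div (first hz0) (hpos _ hz0).ne').deriv]
  have h0 := (hpos z hz).ne'
  simp only [ofReal_zero, zero_mul, add_zero]
  field_simp

lemma planarLaplacian_log_bergmanForm {A : Matrix ι ι ℝ} (hA : A.IsHermitian) {U : Set ℂ}
    (hU : IsOpen U) {f : ℂ → ι → ℂ} (hf : DifferentiableOn ℂ f U)
    (hpos : ∀ z ∈ U, 0 < (bergmanForm A (f z) (f z)).re) {z : ℂ} (hz : z ∈ U) :
    planarLaplacian (fun w => Real.log (bergmanForm A (f w) (f w)).re) z =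
      4 * ((bergmanForm A (f z) (f z)).re * (bergmanForm A (deriv f z) (deriv f z)).re -
        normSq (bergmanForm A (deriv f z) (f z))) / (bergmanForm A (f z) (f z)).re ^ 2 := by
  have h1 := deriv_deriv_log_bergmanForm hA hU hf hpos hz 1
  have hI := deriv_deriv_log_bergmanForm hA hU hf hpos hz I
  simp only [mul_one] at h1
  rw [planarLaplacian, h1, hI]
  have h0 := (hpos z hz).ne'
  simp only [one_pow, one_mul, I_sq, neg_mul, neg_re, map_one, normSq_I, I_mul_re,
    normSq_apply (bergmanForm A (deriv f z) (f z))]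
  field_simp
  ring

end BergmanForm

/-- For a Bergman-type density `ρ = ∑ aᵢⱼ ωᵢ ω̄ⱼ` with `A` real symmetric positive definite
and the `ωᵢ` holomorphic, the Gaussian curvature `K = −(1/(2ρ))Δ(log ρ)` vanishes at
`z₀ ∈ U` iff there is `λ ∈ ℂ` with `ωᵢ′(z₀) = λ ωᵢ(z₀)` for all `i`, i.e. iff the vectors
`(ωᵢ(z₀))` and `(ωᵢ′(z₀))` are ℂ-linearly dependent (note `ρ(z₀) > 0` forces `(ωᵢ(z₀)) ≠ 0`). -/
theorem bergman_curvature_zero_iff {g : ℕ} (U : Set ℂ) (hU : IsOpen U)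
    (ω : Fin g → ℂ → ℂ) (hω : ∀ i, DifferentiableOn ℂ (ω i) U)
    (A : Matrix (Fin g) (Fin g) ℝ) (hA : A.PosDef)
    (ρ : ℂ → ℝ)
    (hρ : ∀ z, ρ z = (∑ i, ∑ j, (A i j : ℂ) * ω i z * conj (ω j z)).re)
    (hρpos : ∀ z ∈ U, 0 < ρ z)
    (z₀ : ℂ) (hz₀ : z₀ ∈ U) :
    -(1 / (2 * ρ z₀)) * planarLaplacian (fun w => Real.log (ρ w)) z₀ = 0 ↔
      ∃ l : ℂ, ∀ i, deriv (ω i) z₀ = l * ω i z₀ := by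
  have hρ' (z : ℂ) : ρ z = (bergmanForm A (fun i => ω i z) (fun i => ω i z)).re := hρ z
  have hf : DifferentiableOn ℂ (fun z i => ω i z) U := differentiableOn_pi.mpr hω
  have hpos : ∀ z ∈ U, 0 < (bergmanForm A (fun i => ω i z) (fun i => ω i z)).re :=
    fun z hz => hρ' z ▸ hρpos z hz
  have hderiv : deriv (fun z i => ω i z) z₀ = fun i => deriv (ω i) z₀ :=
    deriv_pi fun i => (hω i).differentiableAt (hU.mem_nhds hz₀)
  have h0 := (hpos z₀ hz₀).ne'
  have hCS := bergmanForm_cauchySchwarz_eq_iff hA h0 fun i => deriv (ω i) z₀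
  simp only [funext_iff, Pi.smul_apply, smul_eq_mul] at hCS
  simp only [hρ']
  rw [planarLaplacian_log_bergmanForm hA.isHermitian hU hf hpos hz₀, hderiv, ← hCS]
  simp [h0, sub_eq_zero]
end

section
/- Let n ≥ 2 and let M be a real symmetric positive definite n×n matrix (indices 0,…,n−1). Let L, c, C > 0 and suppose: M₀₀ ≥ L; the (n−1)×(n−1) principal submatrix N obtained by deleting row and column 0 satisfies xᵀN x ≥ c·|x|² for all x ∈ ℝ^{n−1}; |M₀ⱼ| ≤ C for all j ≠ 0; and L > (n−1)C²/c. Then for every j ≠ 0, |(M⁻¹)₀ⱼ| ≤ (C·√(n−1)/c)·(M⁻¹)₀₀ ≤ (C·√(n−1)/c)·1/(L − (n−1)C²/c). In particular the off-diagonal entries (M⁻¹)₀ⱼ are O(1/L). -/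
/-- The quadratic inequality behind the Schur-complement estimate: if `c * |x|² ≤ -a * ⟨b, x⟩`,
then Cauchy-Schwarz bounds `|x|` by `a * |b| / c`. -/
theorem sum_sq_le_of_mul_sum_sq_le {ι : Type*} [Fintype ι] (x b : ι → ℝ) {a c K : ℝ}
    (hc : 0 < c) (hb : ∑ i, b i ^ 2 ≤ K)
    (h : c * ∑ i, x i ^ 2 ≤ -a * ∑ i, b i * x i) :
    c ^ 2 * ∑ i, x i ^ 2 ≤ a ^ 2 * K := by
  have hcs := Finset.sum_mul_sq_le_sq_mul_sq Finset.univ b x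
  have hS : 0 ≤ ∑ i, x i ^ 2 := Finset.sum_nonneg fun i _ => sq_nonneg _
  have hK : 0 ≤ K := (Finset.sum_nonneg fun i _ => sq_nonneg (b i)).trans hb
  set S := ∑ i, x i ^ 2
  set d := ∑ i, b i * x i
  rcases hS.eq_or_lt with h0 | hpos
  · rw [← h0, mul_zero]
    positivity
  · have h1 : (c * S) ^ 2 ≤ (-a * d) ^ 2 := pow_le_pow_left₀ (by positivity) h 2
    have h2 : d ^ 2 ≤ K * S := hcs.trans (mul_le_mul_of_nonneg_right hb hS)
    have h3 : a ^ 2 * d ^ 2 ≤ a ^ 2 * (K * S) := mul_le_mul_of_nonneg_left h2 (sq_nonneg a)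
    refine le_of_mul_le_mul_right ?_ hpos
    linarith [show (c * S) ^ 2 = c ^ 2 * S * S by ring,
      show (-a * d) ^ 2 = a ^ 2 * d ^ 2 by ring, show a ^ 2 * (K * S) = a ^ 2 * K * S by ring]


/-- Schur-complement estimate for the off-diagonal entries of the first row of the
inverse: if `M` is real symmetric positive definite of size `n ≥ 2` with `M₀₀ ≥ L`, the
principal submatrix obtained by deleting row and column `0` is `≥ c·Id`, `|M₀ⱼ| ≤ C` for
`j ≠ 0`, and `L > (n−1)C²/c`, then for every `j ≠ 0`,
`|(M⁻¹)₀ⱼ| ≤ (C√(n−1)/c)·(M⁻¹)₀₀ ≤ (C√(n−1)/c)/(L − (n−1)C²/c)`; in particular the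
entries `(M⁻¹)₀ⱼ` are `O(1/L)`. -/
theorem inv_entry_zero_off_estimate {n : ℕ}
    (M : Matrix (Fin (n + 2)) (Fin (n + 2)) ℝ) (hM : M.PosDef)
    (L c C : ℝ) (hL : 0 < L) (hc : 0 < c) (hC : 0 < C)
    (hM00 : L ≤ M 0 0)
    (hN : ∀ x : Fin (n + 1) → ℝ,
      c * ∑ i, x i ^ 2 ≤ ∑ i, ∑ j, x i * M i.succ j.succ * x j)
    (hoff : ∀ j : Fin (n + 2), j ≠ 0 → |M 0 j| ≤ C)
    (hLbig : ((n : ℝ) + 1) * C ^ 2 / c < L) :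
    ∀ j : Fin (n + 2), j ≠ 0 →
      |M⁻¹ 0 j| ≤ C * Real.sqrt ((n : ℝ) + 1) / c * M⁻¹ 0 0 ∧
      C * Real.sqrt ((n : ℝ) + 1) / c * M⁻¹ 0 0 ≤
        C * Real.sqrt ((n : ℝ) + 1) / c * (1 / (L - ((n : ℝ) + 1) * C ^ 2 / c)) := by
  have ha : 0 < M⁻¹ 0 0 := hM.inv.diag_pos
  have hrow : ∀ k, M⁻¹ 0 0 * M 0 k + ∑ i : Fin (n + 1), M⁻¹ 0 i.succ * M i.succ k =
      (1 : Matrix (Fin (n + 2)) (Fin (n + 2)) ℝ) 0 k := fun k => by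
    rw [← Matrix.nonsing_inv_mul M ((Matrix.isUnit_iff_isUnit_det M).1 hM.isUnit),
      Matrix.mul_apply]
    exact (Fin.sum_univ_succ fun i => M⁻¹ 0 i * M i k).symm
  have hsymm : ∀ i j, M i j = M j i := fun i j => by
    simpa using (hM.isHermitian.apply i j).symm
  set a := M⁻¹ 0 0
  set x : Fin (n + 1) → ℝ := fun i => M⁻¹ 0 i.succ
  set b : Fin (n + 1) → ℝ := fun i => M 0 i.succ
  have hquad : ∑ i, ∑ j, x i * M i.succ j.succ * x j = -a * ∑ j, b j * x j := by
    rw [Finset.sum_comm, Finset.mul_sum]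
    refine Finset.sum_congr rfl fun j _ => ?_
    have h := hrow j.succ
    rw [Matrix.one_apply_ne (Fin.succ_ne_zero j).symm] at h
    rw [← Finset.sum_mul]
    linear_combination x j * h
  have hzero : a * M 0 0 + ∑ i, b i * x i = 1 := by
    rw [← Matrix.one_apply_eq (α := ℝ) (0 : Fin (n + 2)), ← hrow 0]
    congr 1
    refine Finset.sum_congr rfl fun i _ => ?_
    rw [hsymm i.succ 0, mul_comm]
  have hbK : ∑ i, b i ^ 2 ≤ ((n : ℝ) + 1) * C ^ 2 := by
    calc ∑ i, b i ^ 2 ≤ ∑ _i : Fin (n + 1), C ^ 2 := Finset.sum_le_sum fun i _ =>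
          sq_le_sq' (abs_le.1 (hoff _ (Fin.succ_ne_zero i))).1
            (abs_le.1 (hoff _ (Fin.succ_ne_zero i))).2
      _ = ((n : ℝ) + 1) * C ^ 2 := by simp
  have hS := sum_sq_le_of_mul_sum_sq_le x b hc hbK ((hN x).trans_eq hquad)
  have hcs := Finset.sum_mul_sq_le_sq_mul_sq Finset.univ b x
  have hsqrt : √((n : ℝ) + 1) ^ 2 = (n : ℝ) + 1 := Real.sq_sqrt (by positivity)
  intro j hj
  constructor
  · obtain ⟨k, rfl⟩ := Fin.exists_succ_eq.2 hj
    refine abs_le_of_sq_le_sq ?_ (by positivity)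
    have hk : x k ^ 2 ≤ ∑ i, x i ^ 2 :=
      Finset.single_le_sum (f := fun i => x i ^ 2) (fun i _ => sq_nonneg _) (Finset.mem_univ k)
    have hrhs : (C * √((n : ℝ) + 1) / c * a) ^ 2 = a ^ 2 * (((n : ℝ) + 1) * C ^ 2) / c ^ 2 := by
      rw [mul_pow, div_pow, mul_pow, hsqrt]
      ring
    rw [hrhs, le_div_iff₀ (by positivity), mul_comm]
    exact (mul_le_mul_of_nonneg_left hk (by positivity)).trans hS
  · refine mul_le_mul_of_nonneg_left ?_ (by positivity)
    rw [le_div_iff₀ (sub_pos.2 hLbig)]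
    have hd : |∑ i, b i * x i| ≤ a * (((n : ℝ) + 1) * C ^ 2 / c) := by
      refine abs_le_of_sq_le_sq ?_ (by positivity)
      have hrhs : (a * (((n : ℝ) + 1) * C ^ 2 / c)) ^ 2 =
          ((n : ℝ) + 1) * C ^ 2 * (a ^ 2 * (((n : ℝ) + 1) * C ^ 2)) / c ^ 2 := by
        ring
      rw [hrhs, le_div_iff₀ (by positivity)]
      calc (∑ i, b i * x i) ^ 2 * c ^ 2
          ≤ (((n : ℝ) + 1) * C ^ 2 * ∑ i, x i ^ 2) * c ^ 2 := by
            gcongr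
            exact hcs.trans (by gcongr)
        _ = ((n : ℝ) + 1) * C ^ 2 * (c ^ 2 * ∑ i, x i ^ 2) := by ring
        _ ≤ _ := by gcongr
    have hLa : a * L ≤ a * M 0 0 := mul_le_mul_of_nonneg_left hM00 ha.le
    linarith [(abs_le.1 hd).1, mul_sub a L (((n : ℝ) + 1) * C ^ 2 / c)]
end

section
/- Let n ≥ 2 and let M be a real symmetric positive definite n×n matrix (indices 0,…,n−1). Let L, c, C > 0 and suppose: M₀₀ ≥ L; the (n−1)×(n−1) principal submatrix N obtained by deleting row and column 0 satisfies xᵀN x ≥ c·|x|² for all x ∈ ℝ^{n−1}; |M₀ⱼ| ≤ C for all j ≠ 0; and L > (n−1)C²/c. Then for every j ≠ 0, 0 < (M⁻¹)ⱼⱼ ≤ 1/(c − (n−1)C²/L). In particular the diagonal entries (M⁻¹)ⱼⱼ with j ≠ 0 are bounded independently of L. -/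
/-- Schur-complement estimate for the remaining diagonal entries of the inverse: if `M`
is real symmetric positive definite of size `n ≥ 2` with `M₀₀ ≥ L`, the principal
submatrix obtained by deleting row and column `0` is `≥ c·Id`, `|M₀ⱼ| ≤ C` for `j ≠ 0`,
and `L > (n−1)C²/c`, then for every `j ≠ 0`, `0 < (M⁻¹)ⱼⱼ ≤ 1/(c − (n−1)C²/L)`; in
particular these diagonal entries are bounded independently of `L`. -/
theorem inv_entry_diag_estimate {n : ℕ}
    (M : Matrix (Fin (n + 2)) (Fin (n + 2)) ℝ) (hM : M.PosDef)
    (L c C : ℝ) (hL : 0 < L) (hc : 0 < c) (hC : 0 < C)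
    (hM00 : L ≤ M 0 0)
    (hN : ∀ x : Fin (n + 1) → ℝ,
      c * ∑ i, x i ^ 2 ≤ ∑ i, ∑ j, x i * M i.succ j.succ * x j)
    (hoff : ∀ j : Fin (n + 2), j ≠ 0 → |M 0 j| ≤ C)
    (hLbig : ((n : ℝ) + 1) * C ^ 2 / c < L) :
    ∀ j : Fin (n + 2), j ≠ 0 →
      0 < M⁻¹ j j ∧ M⁻¹ j j ≤ 1 / (c - ((n : ℝ) + 1) * C ^ 2 / L) := by
  intro j hj
  obtain ⟨k, rfl⟩ := Fin.exists_succ_eq.mpr hj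
  have hpos : 0 < M⁻¹ k.succ k.succ := hM.inv.diag_pos
  refine ⟨hpos, ?_⟩
  have hd : 0 < c - ((n : ℝ) + 1) * C ^ 2 / L := by
    rw [div_lt_iff₀ hc] at hLbig
    rw [sub_pos, div_lt_iff₀ hL]
    linarith
  have hMinv : M * M⁻¹ = 1 := M.mul_nonsing_inv ((Matrix.isUnit_iff_isUnit_det _).mp hM.isUnit)
  have hrow : ∀ i, M i 0 * M⁻¹ 0 k.succ + ∑ l : Fin (n + 1), M i l.succ * M⁻¹ l.succ k.succ
      = if i = k.succ then 1 else 0 := fun i ↦ by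
    rw [← Fin.sum_univ_succ (fun l ↦ M i l * M⁻¹ l k.succ), ← Matrix.mul_apply, hMinv,
      Matrix.one_apply]
  have hsymm : ∀ i, M i 0 = M 0 i := fun i ↦ by simpa using hM.isHermitian.apply 0 i
  set x : Fin (n + 1) → ℝ := fun l ↦ M⁻¹ l.succ k.succ with hx
  set y := M⁻¹ 0 k.succ
  set b := ∑ l : Fin (n + 1), M 0 l.succ * x l with hb
  have hrow0 : M 0 0 * y + b = 0 := by
    simpa [(Fin.succ_ne_zero k).symm] using hrow 0
  have hquad : y * b + ∑ i, ∑ j, x i * M i.succ j.succ * x j = x k := by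
    have hsum : ∑ i : Fin (n + 1), x i * (M i.succ 0 * y + ∑ l : Fin (n + 1),
        M i.succ l.succ * x l) = x k := by
      simp only [hx, hrow]
      simp
    rw [← hsum, hb, Finset.mul_sum, ← Finset.sum_add_distrib]
    refine Finset.sum_congr rfl fun i _ ↦ ?_
    rw [hsymm, mul_add, Finset.mul_sum]
    congr 1
    · ring
    · exact Finset.sum_congr rfl fun l _ ↦ mul_assoc _ _ _
  have hbsq : b ^ 2 ≤ ((n : ℝ) + 1) * C ^ 2 * ∑ i, x i ^ 2 := by
    refine (Finset.sum_mul_sq_le_sq_mul_sq _ _ _).trans ?_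
    gcongr
    refine (Finset.sum_le_card_nsmul _ _ (C ^ 2) fun i _ ↦ ?_).trans (by simp)
    rw [← sq_abs]
    gcongr
    exact hoff _ (Fin.succ_ne_zero i)
  have hM00pos : 0 < M 0 0 := hL.trans_le hM00
  have hyb : -(y * b) ≤ ((n : ℝ) + 1) * C ^ 2 / L * ∑ i, x i ^ 2 := by
    have hy : -(y * b) = b ^ 2 / M 0 0 := by
      rw [eq_div_iff hM00pos.ne']
      linear_combination (-b) * hrow0
    rw [hy, div_mul_eq_mul_div]
    gcongr
  have hle : (c - ((n : ℝ) + 1) * C ^ 2 / L) * ∑ i, x i ^ 2 ≤ x k := by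
    linarith [hN x]
  have hxk : x k ^ 2 ≤ ∑ i, x i ^ 2 :=
    Finset.single_le_sum (f := fun i ↦ x i ^ 2) (fun i _ ↦ sq_nonneg _) (Finset.mem_univ k)
  have hsq := (mul_le_mul_of_nonneg_left hxk hd.le).trans hle
  change x k ≤ _
  have hxpos : 0 < x k := hpos
  rw [le_div_iff₀ hd]
  refine le_of_mul_le_mul_right ?_ hxpos
  linarith
end
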